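/- For every real l > 0 and every real c with 0 < c ≤ πl/2, one has the change-of-variables identity (π/2) ∫_c^{πl/2} dτ / ( Φ(2τ/(πl)) · K(Φ(2τ/(πl))) ) = l · (π²/4) ∫_{Φ(2c/(πl))}^{1} dt/(t·E(t)²); that is, 𝒥_l(c) = l·𝒥(c/l). -/

import Mathlib

open MeasureTheory

/-- Complete Legendre elliptic integral of the second kind. -/
noncomputable def ellE (k : ℝ) : ℝ :=
  ∫ t in (0:ℝ)..1, Real.sqrt ((1 - k^2 * t^2) / (1 - t^2))

/-- Complete Legendre elliptic integral of the first kind. -/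
noncomputable def ellK (k : ℝ) : ℝ :=
  ∫ t in (0:ℝ)..1, 1 / Real.sqrt ((1 - t^2) * (1 - k^2 * t^2))

/-- The function `Ψ(k) = k / E(k)`. -/
noncomputable def PsiFn (k : ℝ) : ℝ := k / ellE k

/-- `Φ`, the inverse on `[0,1]` of the strictly increasing bijection `Ψ`. -/
noncomputable def PhiFn (x : ℝ) : ℝ :=
  sSup {y : ℝ | y ∈ Set.Icc (0:ℝ) 1 ∧ PsiFn y ≤ x}

/-- The function `𝒥(x) = (π²/4) ∫_{Φ(2x/π)}^1 dt/(t E(t)²)`. -/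
noncomputable def Jcal (x : ℝ) : ℝ :=
  (Real.pi^2 / 4) * ∫ t in PhiFn (2*x/Real.pi)..(1:ℝ), 1 / (t * (ellE t)^2)

/-- The function `𝒥_l(c) = (π/2) ∫_c^{πl/2} dτ/(Φ(2τ/(πl)) K(Φ(2τ/(πl))))`. -/
noncomputable def Jl (l c : ℝ) : ℝ :=
  (Real.pi / 2) * ∫ τ in c..(Real.pi * l / 2),
    1 / (PhiFn (2*τ/(Real.pi*l)) * ellK (PhiFn (2*τ/(Real.pi*l))))

/-- The approximation `λ̃_n(c)`. -/
noncomputable def lambdaTilde (n : ℕ) (c : ℝ) : ℝ :=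
  (1/2) * Real.exp (-(Real.pi^2 * ((n:ℝ) + 1/2) / 2) *
    ∫ t in PhiFn (2*c/(Real.pi*((n:ℝ)+1/2)))..(1:ℝ), 1 / (t * (ellE t)^2))

/-- The kernel `sin(c(x-y))/(π(x-y))`, with value `c/π` on the diagonal. -/
noncomputable def sincKernel (c x y : ℝ) : ℝ :=
  if x = y then c / Real.pi else Real.sin (c*(x-y)) / (Real.pi * (x-y))

/-- The quadratic form `⟨Q_c f, f⟩` of the time-and-frequency limiting operator `Q_c`. -/
noncomputable def QForm (c : ℝ) (f : ℝ → ℝ) : ℝ :=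
  ∫ x in Set.Ioo (-1:ℝ) 1, ∫ y in Set.Ioo (-1:ℝ) 1, sincKernel c x y * f y * f x

/-- The `(n+1)`-st eigenvalue `λ_n(c)` of `Q_c`, via the Courant–Fischer min-max principle. -/
noncomputable def lambda (n : ℕ) (c : ℝ) : ℝ :=
  ⨆ V : {V : Submodule ℝ (Lp ℝ 2 (volume.restrict (Set.Ioo (-1:ℝ) 1))) //
          Module.finrank ℝ V = n + 1},
    ⨅ f : {f : Lp ℝ 2 (volume.restrict (Set.Ioo (-1:ℝ) 1)) // f ∈ V.1 ∧ f ≠ 0},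
      QForm c (f.1 : ℝ → ℝ) / ‖f.1‖^2

open Set in
lemma integrableOn_one_div_sqrt_one_sub_sq :
    IntegrableOn (fun t : ℝ => 1 / √(1 - t ^ 2)) (Ioo 0 1) := by
  refine IntegrableOn.mono_set ?_ Ioo_subset_Ioc_self
  refine intervalIntegral.integrableOn_deriv_of_nonneg (g := Real.arcsin)
    Real.continuous_arcsin.continuousOn (fun x hx => ?_) (fun x _ => by positivity)
  exact Real.hasDerivAt_arcsin (by linarith [hx.1]) hx.2.ne

lemma ellE_eq_setIntegral (k : ℝ) :
    ellE k = ∫ t in Set.Ioo (0 : ℝ) 1, √(1 - k ^ 2 * t ^ 2) * (1 / √(1 - t ^ 2)) := by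
  rw [ellE, intervalIntegral.integral_of_le zero_le_one, integral_Ioc_eq_integral_Ioo]
  refine setIntegral_congr_fun measurableSet_Ioo fun t ht => ?_
  have : 0 ≤ 1 - t ^ 2 := by nlinarith [ht.1, ht.2]
  simp only [Real.sqrt_div' _ this, mul_one_div]

lemma ellK_eq_setIntegral (k : ℝ) :
    ellK k = ∫ t in Set.Ioo (0 : ℝ) 1, 1 / √(1 - k ^ 2 * t ^ 2) * (1 / √(1 - t ^ 2)) := by
  rw [ellK, intervalIntegral.integral_of_le zero_le_one, integral_Ioc_eq_integral_Ioo]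
  refine setIntegral_congr_fun measurableSet_Ioo fun t ht => ?_
  have : 0 ≤ 1 - t ^ 2 := by nlinarith [ht.1, ht.2]
  simp only [Real.sqrt_mul this]
  rw [one_div_mul_one_div, mul_comm]

lemma norm_ellE_integrand_le (k t : ℝ) :
    ‖√(1 - k ^ 2 * t ^ 2) * (1 / √(1 - t ^ 2))‖ ≤ 1 / √(1 - t ^ 2) := by
  rw [Real.norm_of_nonneg (by positivity)]
  refine mul_le_of_le_one_left (by positivity) (Real.sqrt_le_one.2 ?_)
  nlinarith [sq_nonneg (k * t)]

lemma integrableOn_ellE_integrand (k : ℝ) :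
    IntegrableOn (fun t : ℝ => √(1 - k ^ 2 * t ^ 2) * (1 / √(1 - t ^ 2))) (Set.Ioo 0 1) := by
  refine Integrable.mono' integrableOn_one_div_sqrt_one_sub_sq ?_
    (.of_forall (norm_ellE_integrand_le k))
  exact (by fun_prop : Measurable _).aestronglyMeasurable

lemma continuous_ellE : Continuous ellE := by
  have h : ellE = fun k => ∫ t in Set.Ioo (0 : ℝ) 1, √(1 - k ^ 2 * t ^ 2) * (1 / √(1 - t ^ 2)) :=
    funext ellE_eq_setIntegral
  rw [h]
  refine continuous_of_dominated (fun k => (integrableOn_ellE_integrand k).aestronglyMeasurable)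
    (fun k => .of_forall (norm_ellE_integrand_le k)) integrableOn_one_div_sqrt_one_sub_sq
    (.of_forall fun t => by fun_prop)

lemma ellE_one : ellE 1 = 1 := by
  rw [ellE_eq_setIntegral, setIntegral_congr_fun (g := fun _ => (1 : ℝ)) measurableSet_Ioo]
  · simp
  · intro t ht
    have : 0 < √(1 - t ^ 2) := Real.sqrt_pos.2 (by nlinarith [ht.1, ht.2])
    simp only [one_pow, one_mul]
    field_simp

lemma ellE_antitoneOn : AntitoneOn ellE (Set.Icc 0 1) := by
  intro a ha b _ hab
  rw [ellE_eq_setIntegral, ellE_eq_setIntegral]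
  refine integral_mono (integrableOn_ellE_integrand b) (integrableOn_ellE_integrand a) fun t => ?_
  have : a ^ 2 ≤ b ^ 2 := pow_le_pow_left₀ ha.1 hab 2
  dsimp only
  gcongr

lemma one_le_ellE {k : ℝ} (hk : k ∈ Set.Icc (0 : ℝ) 1) : 1 ≤ ellE k :=
  ellE_one ▸ ellE_antitoneOn hk (Set.right_mem_Icc.2 zero_le_one) hk.2

lemma hasDerivAt_ellE {k : ℝ} (hk : k ∈ Set.Ioo (0 : ℝ) 1) :
    HasDerivAt ellE ((ellE k - ellK k) / k) k := by
  obtain ⟨hk0, hk1⟩ := hk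
  obtain ⟨r, hkr, hr1⟩ := exists_between hk1
  have hpos : ∀ x ∈ Set.Ioo 0 r, ∀ t ∈ Set.Ioo (0 : ℝ) 1, 1 - r ^ 2 ≤ 1 - x ^ 2 * t ^ 2 := by
    intro x hx t ht
    have h1 : x ^ 2 ≤ r ^ 2 := pow_le_pow_left₀ hx.1.le hx.2.le 2
    have h2 : t ^ 2 ≤ 1 := pow_le_one₀ ht.1.le ht.2.le
    nlinarith [sq_nonneg x, sq_nonneg t]
  have hr : 0 < 1 - r ^ 2 := by nlinarith
  have key := hasDerivAt_integral_of_dominated_loc_of_deriv_le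
    (μ := volume.restrict (Set.Ioo (0 : ℝ) 1)) (x₀ := k) (s := Set.Ioo 0 r)
    (F := fun k t => √(1 - k ^ 2 * t ^ 2) * (1 / √(1 - t ^ 2)))
    (F' := fun k t => -(k * t ^ 2) / √(1 - k ^ 2 * t ^ 2) * (1 / √(1 - t ^ 2)))
    (bound := fun t => 1 / √(1 - r ^ 2) * (1 / √(1 - t ^ 2)))
    (Ioo_mem_nhds hk0 hkr)
    (.of_forall fun x => (integrableOn_ellE_integrand x).aestronglyMeasurable)
    (integrableOn_ellE_integrand k)
    (by exact (by fun_prop : Measurable _).aestronglyMeasurable)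
    (by
      filter_upwards [ae_restrict_mem measurableSet_Ioo] with t ht x hx
      have h1 := hpos x hx t ht
      have h2 : t ^ 2 ≤ 1 := pow_le_one₀ ht.1.le ht.2.le
      have h3 : 0 < √(1 - r ^ 2) := Real.sqrt_pos.2 hr
      have h4 : x * t ^ 2 ≤ 1 := by nlinarith [hx.1, hx.2, sq_nonneg t]
      have h5 : 0 ≤ x * t ^ 2 := mul_nonneg hx.1.le (sq_nonneg t)
      rw [norm_mul, norm_div, norm_neg, Real.norm_of_nonneg h5,
        Real.norm_of_nonneg (Real.sqrt_nonneg _),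
        Real.norm_of_nonneg (by positivity : 0 ≤ 1 / √(1 - t ^ 2))]
      gcongr)
    (integrableOn_one_div_sqrt_one_sub_sq.const_mul _)
    (by
      filter_upwards [ae_restrict_mem measurableSet_Ioo] with t ht x hx
      have h1 : 0 < 1 - x ^ 2 * t ^ 2 := hr.trans_le (hpos x hx t ht)
      have h2 : HasDerivAt (fun x : ℝ => 1 - x ^ 2 * t ^ 2) (-(2 * x * t ^ 2)) x := by
        simpa using ((hasDerivAt_pow 2 x).mul_const (t ^ 2)).const_sub 1
      refine ((h2.sqrt h1.ne').mul_const (1 / √(1 - t ^ 2))).congr_deriv ?_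
      have h3 : 0 < √(1 - x ^ 2 * t ^ 2) := Real.sqrt_pos.2 h1
      field_simp)
  have hK : ellK k = ellE k -
      k * ∫ t in Set.Ioo (0 : ℝ) 1, -(k * t ^ 2) / √(1 - k ^ 2 * t ^ 2) * (1 / √(1 - t ^ 2)) := by
    rw [ellK_eq_setIntegral, ellE_eq_setIntegral, ← integral_const_mul,
      ← integral_sub (integrableOn_ellE_integrand k) (key.1.const_mul k)]
    refine setIntegral_congr_fun measurableSet_Ioo fun t ht => ?_
    have h1 : 0 < 1 - k ^ 2 * t ^ 2 := hr.trans_le (hpos k ⟨hk0, hkr⟩ t ht)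
    have h3 : 0 < √(1 - k ^ 2 * t ^ 2) := Real.sqrt_pos.2 h1
    have h4 := Real.sq_sqrt h1.le
    rw [← mul_assoc, ← sub_mul]
    congr 1
    field_simp
    rw [h4]
    ring
  have hE : ellE = fun k => ∫ t in Set.Ioo (0 : ℝ) 1, √(1 - k ^ 2 * t ^ 2) * (1 / √(1 - t ^ 2)) :=
    funext ellE_eq_setIntegral
  rw [hK, sub_sub_cancel, mul_div_cancel_left₀ _ hk0.ne', hE]
  exact key.2

lemma hasDerivAt_PsiFn {k : ℝ} (hk : k ∈ Set.Ioo (0 : ℝ) 1) :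
    HasDerivAt PsiFn (ellK k / ellE k ^ 2) k := by
  have hE := one_le_ellE (Set.Ioo_subset_Icc_self hk)
  have h := (hasDerivAt_id k).div (hasDerivAt_ellE hk) (by linarith)
  have hk0 := hk.1.ne'
  refine h.congr_deriv ?_
  simp only [id]
  field_simp
  ring

lemma ellK_pos {k : ℝ} (hk : k ∈ Set.Ioo (0 : ℝ) 1) : 0 < ellK k := by
  have h : derivWithin ellE (Set.Icc 0 1) k ≤ 0 := ellE_antitoneOn.derivWithin_nonpos
  rw [((hasDerivAt_ellE hk).hasDerivWithinAt).derivWithin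
    ((uniqueDiffOn_Icc zero_lt_one) k (Set.Ioo_subset_Icc_self hk)),
    div_le_iff₀ hk.1] at h
  linarith [one_le_ellE (Set.Ioo_subset_Icc_self hk)]

lemma continuousOn_PsiFn : ContinuousOn PsiFn (Set.Icc 0 1) :=
  continuousOn_id.div continuous_ellE.continuousOn fun k hk => by linarith [one_le_ellE hk]

lemma strictMonoOn_PsiFn : StrictMonoOn PsiFn (Set.Icc 0 1) := by
  intro a ha b hb hab
  have := one_le_ellE hb
  exact div_lt_div₀ hab (ellE_antitoneOn ha hb hab.le) hb.1 (by linarith)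

lemma PsiFn_zero : PsiFn 0 = 0 := zero_div _

lemma PsiFn_one : PsiFn 1 = 1 := by rw [PsiFn, ellE_one, div_one]

lemma PhiFn_PsiFn {k : ℝ} (hk : k ∈ Set.Icc (0 : ℝ) 1) : PhiFn (PsiFn k) = k := by
  have : {y : ℝ | y ∈ Set.Icc (0 : ℝ) 1 ∧ PsiFn y ≤ PsiFn k} = Set.Icc 0 k := by
    ext y
    constructor
    · rintro ⟨hy, h⟩
      exact ⟨hy.1, (strictMonoOn_PsiFn.le_iff_le hy hk).1 h⟩
    · intro hy
      have hy' : y ∈ Set.Icc (0 : ℝ) 1 := ⟨hy.1, hy.2.trans hk.2⟩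
      exact ⟨hy', (strictMonoOn_PsiFn.le_iff_le hy' hk).2 hy.2⟩
  rw [PhiFn, this, csSup_Icc hk.1]

lemma image_PsiFn_Ioo {a : ℝ} (ha : a ∈ Set.Icc (0 : ℝ) 1) (m : ℝ) (hm : 0 < m) :
    (fun t => m * PsiFn t) '' Set.Ioo a 1 = Set.Ioo (m * PsiFn a) m := by
  have hsub : Set.Icc a 1 ⊆ Set.Icc 0 1 := Set.Icc_subset_Icc_left ha.1
  have hmono : StrictMonoOn (fun t => m * PsiFn t) (Set.Icc a 1) := fun x hx y hy hxy =>
    mul_lt_mul_of_pos_left (strictMonoOn_PsiFn (hsub hx) (hsub hy) hxy) hm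
  have h1 : m * PsiFn 1 = m := by rw [PsiFn_one, mul_one]
  refine Set.Subset.antisymm ?_ ?_
  · simpa only [h1] using hmono.image_Ioo_subset
  · have := intermediate_value_Ioo ha.2 (f := fun t => m * PsiFn t)
      ((continuousOn_PsiFn.mono hsub).const_mul m)
    simpa only [h1] using this

theorem stmt16 (l c : ℝ) (hl : 0 < l) (hc : 0 < c) (hc2 : c ≤ Real.pi * l / 2) :
    Jl l c = l * Jcal (c/l) := by
  have hpi := Real.pi_pos
  have hm : 0 < Real.pi * l / 2 := by positivity
  obtain ⟨a, ha, hax⟩ : 2 * c / (Real.pi * l) ∈ PsiFn '' Set.Icc 0 1 := by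
    refine intermediate_value_Icc zero_le_one continuousOn_PsiFn ?_
    rw [PsiFn_zero, PsiFn_one]
    refine ⟨by positivity, ?_⟩
    rw [div_le_one (by positivity)]
    linarith
  have hca : Real.pi * l / 2 * PsiFn a = c := by rw [hax]; field_simp
  have hsub : Set.Ioo a 1 ⊆ Set.Ioo 0 1 := Set.Ioo_subset_Ioo_left ha.1
  have hx : 2 * (c / l) / Real.pi = PsiFn a := by rw [hax]; field_simp
  rw [Jl, Jcal, hx, PhiFn_PsiFn ha, intervalIntegral.integral_of_le hc2,
    intervalIntegral.integral_of_le ha.2, integral_Ioc_eq_integral_Ioo,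
    integral_Ioc_eq_integral_Ioo]
  have himg := image_PsiFn_Ioo ha _ hm
  rw [hca] at himg
  rw [← himg, integral_image_eq_integral_abs_deriv_smul measurableSet_Ioo
    (fun t ht => ((hasDerivAt_PsiFn (hsub ht)).const_mul _).hasDerivWithinAt)
    (fun x hx y hy hxy => strictMonoOn_PsiFn.injOn (Set.Ioo_subset_Icc_self (hsub hx))
      (Set.Ioo_subset_Icc_self (hsub hy)) (mul_left_cancel₀ hm.ne' hxy)),
    ← integral_const_mul, ← integral_const_mul, ← integral_const_mul]
  refine setIntegral_congr_fun measurableSet_Ioo fun t ht => ?_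
  have ht' := hsub ht
  have hE := one_le_ellE (Set.Ioo_subset_Icc_self ht')
  have hK := ellK_pos ht'
  have ht0 := ht'.1
  have hΨ : 2 * (Real.pi * l / 2 * PsiFn t) / (Real.pi * l) = PsiFn t := by field_simp
  have hE0 : 0 < ellE t := by linarith
  rw [hΨ, PhiFn_PsiFn (Set.Ioo_subset_Icc_self ht'), abs_of_pos (by positivity), smul_eq_mul]
  field_simp
  norm_num
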